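/- For all integers k ≥ 1 and n ≥ k + 2, ∑_{m=1}^∞ λ(m)·τ(m)·σ'_k(m)/m^n = ζ(2n)²·ζ(n−k)²·ζ(2n−k)/(ζ(n)²·ζ(4n−2k)). -/

import Mathlib

/-- Liouville's function `λ(m) = (-1)^Ω(m)`. -/
def liouvilleLambda (m : ℕ) : ℤ := (-1) ^ (ArithmeticFunction.cardFactors m)

/-- `σ'_k(m) = ∑_{d ∣ m} λ(d) d^k`. -/
def sigmaPrime (k m : ℕ) : ℤ := ∑ d ∈ m.divisors, liouvilleLambda d * (d : ℤ) ^ k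

theorem Nat.card_divisors_mul_le (a b : ℕ) :
    (a * b).divisors.card ≤ a.divisors.card * b.divisors.card := by
  open scoped Pointwise in
  rw [Nat.divisors_mul]
  exact Finset.card_mul_le

/-- The Dirichlet series `∑ τ(m)² / m²` converges absolutely. -/
theorem summable_card_divisors_sq_div_sq :
    Summable fun m : ℕ ↦ ((m.divisors.card : ℝ) ^ 2 / (m : ℝ) ^ 2) := by
  have hone : LSeriesSummable (1 : ℕ → ℂ) 2 := LSeriesSummable_one_iff.mpr (by norm_num)
  have htau := hone.convolution hone
  have htau4 := htau.convolution htau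
  have hcard (m : ℕ) : LSeries.convolution (1 : ℕ → ℂ) 1 m = (m.divisors.card : ℂ) := by
    rw [LSeries.convolution_def]
    simp [← Nat.map_div_right_divisors]
  refine Summable.of_nonneg_of_le (fun m ↦ by positivity) (fun m ↦ ?_) htau4.norm
  rcases eq_or_ne m 0 with rfl | hm
  · simp
  rw [LSeries.norm_term_eq, if_neg hm]
  have h2 : (m : ℝ) ^ (2 : ℂ).re = (m : ℝ) ^ 2 := by norm_num
  rw [h2]
  gcongr
  rw [LSeries.convolution_def]
  have hnat : m.divisors.card ^ 2 ≤
      ∑ p ∈ m.divisorsAntidiagonal, p.1.divisors.card * p.2.divisors.card := by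
    calc m.divisors.card ^ 2 = ∑ p ∈ m.divisorsAntidiagonal, m.divisors.card := by
          rw [Finset.sum_const, smul_eq_mul, sq, ← Nat.map_div_right_divisors, Finset.card_map]
      _ ≤ _ := Finset.sum_le_sum fun p hp ↦ by
          rw [← (Nat.mem_divisorsAntidiagonal.mp hp).1]
          exact Nat.card_divisors_mul_le _ _
  simp only [hcard]
  have hnorm : ‖∑ p ∈ m.divisorsAntidiagonal, (p.1.divisors.card : ℂ) * (p.2.divisors.card : ℂ)‖
      = ((∑ p ∈ m.divisorsAntidiagonal, p.1.divisors.card * p.2.divisors.card : ℕ) : ℝ) := by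
    rw [← Complex.norm_natCast]
    push_cast
    rfl
  rw [hnorm]
  exact_mod_cast hnat

theorem liouvilleLambda_mul {a b : ℕ} (ha : a ≠ 0) (hb : b ≠ 0) :
    liouvilleLambda (a * b) = liouvilleLambda a * liouvilleLambda b := by
  simp [liouvilleLambda, ArithmeticFunction.cardFactors_mul ha hb, pow_add]

theorem liouvilleLambda_prime_pow {p : ℕ} (hp : p.Prime) (e : ℕ) :
    liouvilleLambda (p ^ e) = (-1) ^ e := by
  simp [liouvilleLambda, ArithmeticFunction.cardFactors_apply_prime_pow hp]

theorem abs_liouvilleLambda (m : ℕ) : |liouvilleLambda m| = 1 := by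
  simp [liouvilleLambda]

theorem sigmaPrime_mul_of_coprime (k : ℕ) {a b : ℕ} (hab : a.Coprime b) :
    sigmaPrime k (a * b) = sigmaPrime k a * sigmaPrime k b := by
  open scoped Pointwise in
  rw [sigmaPrime, Nat.divisors_mul, Finset.mul_def, Finset.sum_image hab.mul_injOn_divisors,
    Finset.sum_product, sigmaPrime, sigmaPrime, Finset.sum_mul_sum]
  refine Finset.sum_congr rfl fun x hx ↦ Finset.sum_congr rfl fun y hy ↦ ?_
  rw [liouvilleLambda_mul (Nat.pos_of_mem_divisors hx).ne' (Nat.pos_of_mem_divisors hy).ne']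
  push_cast
  ring

theorem sigmaPrime_prime_pow (k : ℕ) {p : ℕ} (hp : p.Prime) (e : ℕ) :
    sigmaPrime k (p ^ e) = ∑ j ∈ Finset.range (e + 1), (-(p : ℤ) ^ k) ^ j := by
  rw [sigmaPrime, Nat.sum_divisors_prime_pow hp]
  refine Finset.sum_congr rfl fun j _ ↦ ?_
  rw [liouvilleLambda_prime_pow hp]
  push_cast
  rw [neg_pow (_ ^ k), ← pow_mul, ← pow_mul, mul_comm k]

theorem abs_sigmaPrime_le (k m : ℕ) : |sigmaPrime k m| ≤ m.divisors.card * (m : ℤ) ^ k := by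
  refine (Finset.abs_sum_le_sum_abs _ _).trans ?_
  rw [← nsmul_eq_mul]
  refine Finset.sum_le_card_nsmul _ _ _ fun d hd ↦ ?_
  rw [abs_mul, abs_liouvilleLambda, one_mul, abs_of_nonneg (by positivity)]
  have := Nat.divisor_le hd
  gcongr

/-- `∑ (e + 1) (-x)^e (1 - q + ⋯ + (-q)^e)` in closed form. -/
theorem hasSum_succ_mul_neg_pow_mul_geom {q x : ℂ} (hq : 1 + q ≠ 0) (hx : ‖x‖ < 1)
    (hqx : ‖q * x‖ < 1) :
    HasSum (fun e : ℕ ↦ ((e : ℂ) + 1) * (-x) ^ e * ∑ j ∈ Finset.range (e + 1), (-q) ^ j)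
      ((1 + q * x ^ 2) * ((1 + x) ^ 2)⁻¹ * ((1 - q * x) ^ 2)⁻¹) := by
  have key {r : ℂ} (hr : ‖r‖ < 1) :
      HasSum (fun e : ℕ ↦ ((e : ℂ) + 1) * r ^ e) (1 / (1 - r) ^ 2) := by
    simpa using hasSum_choose_mul_geometric_of_norm_lt_one 1 hr
  have hx' : ‖-x‖ < 1 := by rwa [norm_neg]
  have h1 : 1 + x ≠ 0 := fun h ↦ by
    rw [← eq_neg_iff_add_eq_zero.mpr h] at hx'; simp at hx'
  have h2 : 1 - q * x ≠ 0 := fun h ↦ by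
    rw [← sub_eq_zero.mp h] at hqx; simp at hqx
  have hsum := ((key hx').add ((key hqx).mul_left q)).div_const (1 + q)
  have hval : (1 / (1 - -x) ^ 2 + q * (1 / (1 - q * x) ^ 2)) / (1 + q) =
      (1 + q * x ^ 2) * ((1 + x) ^ 2)⁻¹ * ((1 - q * x) ^ 2)⁻¹ := by
    have h2' : 1 - x * q ≠ 0 := by rwa [mul_comm]
    rw [sub_neg_eq_add]
    field_simp
    ring
  rw [hval] at hsum
  convert! hsum using 2 with e
  have hg := geom_sum_mul (-q) (e + 1)
  rw [eq_div_iff hq]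
  have : (-x) ^ e * (-q) ^ (e + 1) = - (q * (q * x) ^ e) := by
    rw [pow_succ, ← mul_assoc, ← mul_pow]; ring
  linear_combination (-((e : ℂ) + 1) * (-x) ^ e) * hg - ((e : ℂ) + 1) * this

theorem riemannZeta_natCast_hasProd {s : ℕ} (hs : 2 ≤ s) :
    HasProd (fun p : Nat.Primes ↦ (1 - ((p : ℂ) ^ s)⁻¹)⁻¹) (riemannZeta (s : ℂ)) := by
  have := riemannZeta_eulerProduct_hasProd (s := s) (by simpa using show 1 < s by omega)
  simpa [Complex.cpow_neg] using this

/-- For all integers `k ≥ 1` and `n ≥ k + 2`,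
`∑_{m=1}^∞ λ(m)·τ(m)·σ'_k(m)/m^n = ζ(2n)²·ζ(n−k)²·ζ(2n−k)/(ζ(n)²·ζ(4n−2k))`. -/
theorem stmt17 (k n : ℕ) (hk : 1 ≤ k) (hn : k + 2 ≤ n) :
    ∑' m : ℕ+,
        ((liouvilleLambda (m : ℕ) : ℤ) : ℂ) * ((m : ℕ).divisors.card : ℂ) *
            ((sigmaPrime k (m : ℕ) : ℤ) : ℂ) / ((m : ℕ) : ℂ) ^ n
      = riemannZeta ((2 * n : ℕ) : ℂ) ^ 2 * riemannZeta ((n - k : ℕ) : ℂ) ^ 2 *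
          riemannZeta ((2 * n - k : ℕ) : ℂ) /
          (riemannZeta (n : ℂ) ^ 2 * riemannZeta ((4 * n - 2 * k : ℕ) : ℂ)) := by
  set f : ℕ → ℂ := fun m ↦ ((liouvilleLambda m : ℤ) : ℂ) * (m.divisors.card : ℂ) *
    ((sigmaPrime k m : ℤ) : ℂ) / (m : ℂ) ^ n with hf
  have hf0 : f 0 = 0 := by simp [hf]
  have hf1 : f 1 = 1 := by simp [hf, liouvilleLambda, sigmaPrime]
  have hmul {a b : ℕ} (hab : a.Coprime b) : f (a * b) = f a * f b := by
    rcases eq_or_ne a 0 with rfl | ha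
    · simp [hf0]
    rcases eq_or_ne b 0 with rfl | hb
    · simp [hf0]
    simp only [hf, liouvilleLambda_mul ha hb, sigmaPrime_mul_of_coprime k hab,
      hab.card_divisors_mul]
    push_cast
    rw [mul_pow, div_mul_div_comm]
    ring
  have hsum : Summable (‖f ·‖) := by
    refine Summable.of_nonneg_of_le (fun m ↦ norm_nonneg _) (fun m ↦ ?_)
      summable_card_divisors_sq_div_sq
    rcases eq_or_ne m 0 with rfl | hm
    · simp [hf0]
    have hm1 : (1 : ℝ) ≤ m := by exact_mod_cast Nat.one_le_iff_ne_zero.mpr hm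
    have hl : |(liouvilleLambda m : ℝ)| = 1 := by exact_mod_cast abs_liouvilleLambda m
    have hs : |(sigmaPrime k m : ℝ)| ≤ m.divisors.card * (m : ℝ) ^ k := by
      exact_mod_cast abs_sigmaPrime_le k m
    simp only [hf, norm_div, norm_mul, norm_pow, Complex.norm_natCast, Complex.norm_intCast, hl,
      one_mul]
    rw [div_le_div_iff₀ (by positivity) (by positivity)]
    calc (m.divisors.card : ℝ) * |(sigmaPrime k m : ℝ)| * (m : ℝ) ^ 2
        ≤ m.divisors.card * (m.divisors.card * (m : ℝ) ^ k) * (m : ℝ) ^ 2 := by gcongr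
      _ = (m.divisors.card : ℝ) ^ 2 * (m : ℝ) ^ (k + 2) := by ring
      _ ≤ (m.divisors.card : ℝ) ^ 2 * (m : ℝ) ^ n := by gcongr
  have hlocal (p : Nat.Primes) : ∑' e, f ((p : ℕ) ^ e) =
      (1 + (p : ℂ) ^ k * (((p : ℂ) ^ n)⁻¹) ^ 2) * ((1 + ((p : ℂ) ^ n)⁻¹) ^ 2)⁻¹ *
        ((1 - (p : ℂ) ^ k * ((p : ℂ) ^ n)⁻¹) ^ 2)⁻¹ := by
    have hp1 : (1 : ℝ) < (p : ℕ) := by exact_mod_cast p.2.one_lt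
    rw [← (hasSum_succ_mul_neg_pow_mul_geom ?_ ?_ ?_).tsum_eq]
    · refine tsum_congr fun e ↦ ?_
      simp only [hf, liouvilleLambda_prime_pow p.2, sigmaPrime_prime_pow k p.2,
        Nat.divisors_prime_pow p.2, Finset.card_map, Finset.card_range]
      push_cast
      rw [neg_pow (_⁻¹), inv_pow, ← pow_mul, ← pow_mul, mul_comm n e]
      ring
    · exact_mod_cast (show 1 + (p : ℕ) ^ k ≠ 0 by omega)
    · rw [norm_inv, norm_pow, Complex.norm_natCast]
      exact inv_lt_one_of_one_lt₀ (one_lt_pow₀ hp1 (by omega))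
    · rw [norm_mul, norm_inv, norm_pow, norm_pow, Complex.norm_natCast, ← div_eq_mul_inv,
        div_lt_one (by positivity)]
      exact pow_lt_pow_right₀ hp1 (by omega)
  have hprod := EulerProduct.eulerProduct_hasProd hf1 hmul hsum hf0
  have hpnat : ∑' m : ℕ+, f m = ∑' m, f m := PNat.coe_injective.tsum_eq fun m hm ↦
    ⟨⟨m, Nat.pos_of_ne_zero fun h ↦ hm (h ▸ hf0)⟩, rfl⟩
  rw [hpnat]
  have hz := fun {s : ℕ} (hs : 2 ≤ s) ↦ riemannZeta_natCast_hasProd hs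
  have hne {s : ℕ} (hs : 2 ≤ s) : riemannZeta (s : ℂ) ≠ 0 :=
    riemannZeta_ne_zero_of_one_lt_re (by simpa using show 1 < s by omega)
  have hn2 : 2 ≤ n := by omega
  have h4 : 2 ≤ 4 * n - 2 * k := by omega
  rw [eq_div_iff (mul_ne_zero (pow_ne_zero 2 (hne hn2)) (hne h4)), pow_two, pow_two, pow_two]
  refine HasProd.unique (hprod.mul (((hz hn2).mul (hz hn2)).mul (hz h4))) ?_
  have h2n := hz (show 2 ≤ 2 * n by omega)
  have hnk := hz (show 2 ≤ n - k by omega)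
  convert ((h2n.mul h2n).mul (hnk.mul hnk)).mul (hz (show 2 ≤ 2 * n - k by omega)) using 2 with p
  rw [hlocal]
  obtain ⟨d, rfl⟩ := Nat.exists_eq_add_of_le (show k ≤ n by omega)
  have hp0 : ((p : ℕ) : ℂ) ≠ 0 := by exact_mod_cast p.2.ne_zero
  have e1 : k + d - k = d := by omega
  have e2 : 2 * (k + d) - k = k + d + d := by omega
  have e3 : 4 * (k + d) - 2 * k = (k + d + d) * 2 := by omega
  rw [e1, e2, e3, mul_comm 2, pow_mul, pow_mul]
  have hsub {s : ℕ} (hs : 1 ≤ s) : ((p : ℕ) : ℂ) ^ s - 1 ≠ 0 := by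
    rw [sub_ne_zero]
    exact_mod_cast (one_lt_pow₀ p.2.one_lt (by omega : s ≠ 0)).ne'
  have hadd (s : ℕ) : ((p : ℕ) : ℂ) ^ s + 1 ≠ 0 := by exact_mod_cast Nat.succ_ne_zero ((p : ℕ) ^ s)
  have a1 := hsub (show 1 ≤ k + d by omega)
  have a2 := hsub (show 1 ≤ d by omega)
  have a3 := hsub (show 1 ≤ k + d + d by omega)
  have b1 := hadd (k + d)
  have b3 := hadd (k + d + d)
  simp only [pow_add] at a1 a2 a3 b1 b3 ⊢
  have hP : ((p : ℕ) : ℂ) ^ k ≠ 0 := pow_ne_zero _ hp0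
  have hQ : ((p : ℕ) : ℂ) ^ d ≠ 0 := pow_ne_zero _ hp0
  generalize ((p : ℕ) : ℂ) ^ k = P at *
  generalize ((p : ℕ) : ℂ) ^ d = Q at *
  have a3' : P * Q ^ 2 - 1 ≠ 0 := by rwa [sq, ← mul_assoc]
  have b3' : P * Q ^ 2 + 1 ≠ 0 := by rwa [sq, ← mul_assoc]
  have f1 : 1 - ((P * Q) ^ 2)⁻¹ = (P * Q - 1) * (P * Q + 1) / (P * Q) ^ 2 := by
    field_simp; ring
  have f2 : 1 - ((P * Q * Q) ^ 2)⁻¹ = (P * Q * Q - 1) * (P * Q * Q + 1) / (P * Q * Q) ^ 2 := by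
    field_simp; ring
  have f3 : 1 - (P * Q)⁻¹ = (P * Q - 1) / (P * Q) := by field_simp
  have f4 : 1 - Q⁻¹ = (Q - 1) / Q := by field_simp
  have f5 : 1 - (P * Q * Q)⁻¹ = (P * Q * Q - 1) / (P * Q * Q) := by field_simp
  have f6 : 1 + (P * Q)⁻¹ = (P * Q + 1) / (P * Q) := by field_simp
  have f7 : 1 - P * (P * Q)⁻¹ = (Q - 1) / Q := by field_simp
  have f8 : 1 + P * ((P * Q)⁻¹) ^ 2 = (P * Q * Q + 1) / (P * Q * Q) := by field_simp
  rw [f1, f2, f3, f4, f5, f6, f7, f8]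
  field_simp
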